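/- Let c be a finitely supported real-valued function on nonempty finite lists of nonzero integers, and define S(n) = Σ_a c(a)·S_a(n), the corresponding finite linear combination of nested harmonic sums. Then S(2n+1) = S(2n) for every natural number n if and only if c((a)⌢b) = c((−a)⌢b) for every nonzero integer a and every (possibly empty) list b of nonzero integers. -/

import Mathlib

/-- Nested (signed) harmonic sum `S_{a₁,…,a_ℓ}(N)`,
`S_{a₁,…,a_ℓ}(N) = Σ_{n=1}^{N} (sign a₁)^n / n^{|a₁|} · S_{a₂,…,a_ℓ}(n)`, with `S_{}(n) = 1`. -/
noncomputable def nestedS : List ℤ → ℕ → ℝ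
  | [], _ => 1
  | a :: b, N => ∑ n ∈ Finset.Icc 1 N, ((Int.sign a : ℝ)) ^ n / (n : ℝ) ^ a.natAbs * nestedS b n

open Polynomial Filter

/-- A family indexed by words on which a semilinear map `σ` acts unipotently with respect to the
length of words is linearly independent, provided that no nontrivial combination with
`τ`-invariant coefficients of the first subdiagonal entries `f a` telescopes. -/
theorem linearIndependent_of_unipotent_shift {ι K A : Type*} [Field K] [AddCommGroup A]
    [Module K A] (τ : K →+* K) (σ : A →+ A) (hσ : ∀ k x, σ (k • x) = τ k • σ x)
    (s : List ι → A) (hnil : s [] ≠ 0) (t : List ι → List ι →₀ K) (f : ι → K)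
    (hst : ∀ w, σ (s w) = Finsupp.linearCombination K s (t w))
    (ht₀ : ∀ w v, w.length ≤ v.length → t w v = Finsupp.single w 1 v)
    (ht₁ : ∀ a w v, w.length = v.length → t (a :: w) v = Finsupp.single w (f a) v)
    (hf : ∀ (ρ : ι →₀ K) (g : K), (∀ a, τ (ρ a) = ρ a) →
      τ g - g + ρ.sum (fun a r => r * f a) = 0 → ρ = 0) :
    LinearIndependent K s := by
  classical
  rw [linearIndependent_iff]
  suffices H : ∀ (n : ℕ) (l : List ι →₀ K), (∀ w ∈ l.support, w.length ≤ n) →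
      Finsupp.linearCombination K s l = 0 → l = 0 from fun l hl =>
    H (l.support.sup List.length) l (fun w hw => Finset.le_sup (f := List.length) hw) hl
  intro n
  induction n with
  | zero =>
    intro l hl h
    have hl' : l = Finsupp.single [] (l []) := by
      ext w
      by_cases hw : w = []
      · simp [hw]
      · rw [Finsupp.single_eq_of_ne hw]
        by_contra hne
        exact hw (List.length_eq_zero_iff.1 (Nat.le_zero.1 (hl w (by simpa using hne))))
    rw [hl', Finsupp.linearCombination_single] at h
    rw [hl', (smul_eq_zero.1 h).resolve_right hnil, Finsupp.single_zero]
  | succ n ih =>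
    suffices H : ∀ (m : ℕ) (l : List ι →₀ K), (∀ w ∈ l.support, w.length ≤ n + 1) →
        (l.support.filter (fun w => w.length = n + 1)).card ≤ m →
        Finsupp.linearCombination K s l = 0 → l = 0 from fun l hl h => H _ l hl le_rfl h
    intro m
    induction m with
    | zero =>
      intro l hl hm h
      refine ih l (fun w hw => ?_) h
      have := Finset.filter_eq_empty_iff.1 (Finset.card_eq_zero.1 (Nat.le_zero.1 hm)) hw
      have := hl w hw
      omega
    | succ m ihm =>
      intro l hl hm h
      by_cases htop : ∃ w₀, w₀.length = n + 1 ∧ l w₀ ≠ 0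
      swap
      · refine ih l (fun w hw => ?_) h
        have h1 := hl w hw
        by_contra h2
        exact htop ⟨w, by omega, by simpa using hw⟩
      exfalso
      obtain ⟨w₀, hw₀, hne⟩ := htop
      set r : List ι →₀ K := (l w₀)⁻¹ • l with hr
      have hr₀ : r w₀ = 1 := by simp [hr, hne]
      have hrl : ∀ w, n + 1 < w.length → r w = 0 := fun w hw => by
        have : l w = 0 := by
          by_contra hlw
          have := hl w (by simpa using hlw)
          omega
        simp [hr, this]
      have hev : Finsupp.linearCombination K s r = 0 := by simp [hr, h]
      set T : List ι →₀ K := r.sum (fun w k => τ k • t w) with hT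
      have hTev : Finsupp.linearCombination K s T = 0 := by
        have : σ (Finsupp.linearCombination K s r) = Finsupp.linearCombination K s T := by
          rw [hT, Finsupp.linearCombination_apply, Finsupp.sum, Finsupp.sum, map_sum, map_sum]
          exact Finset.sum_congr rfl fun w _ => by rw [hσ, hst, map_smul]
        rw [← this, hev, map_zero]
      have hTapp : ∀ v, T v = ∑ w ∈ r.support, τ (r w) * t w v := fun v => by
        simp [hT, Finsupp.sum, Finsupp.finsetSum_apply]
      have hdiag : ∀ v, (∑ w ∈ r.support, τ (r w) * Finsupp.single w (1 : K) v) = τ (r v) :=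
        fun v => by
          rw [Finset.sum_eq_single v]
          · simp
          · intro w _ hw
            rw [Finsupp.single_eq_of_ne (Ne.symm hw), mul_zero]
          · intro hv
            simp [Finsupp.notMem_support_iff.1 hv]
      have hlen : ∀ w ∈ r.support, w.length ≤ n + 1 := fun w hw => by
        by_contra hlt
        exact (Finsupp.mem_support_iff.1 hw) (hrl w (by omega))
      have hTtop : ∀ v, n + 1 ≤ v.length → T v = τ (r v) := fun v hv => by
        rw [hTapp, ← hdiag v]
        exact Finset.sum_congr rfl fun w hw => by rw [ht₀ w v ((hlen w hw).trans hv)]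
      have hTr : T - r = 0 := by
        refine ihm _ (fun w hw => ?_) ?_ (by rw [map_sub, hTev, hev, sub_zero])
        · by_contra hlt
          apply Finsupp.mem_support_iff.1 hw
          rw [Finsupp.sub_apply, hTtop w (by omega), hrl w (by omega), map_zero, sub_zero]
        · refine Nat.lt_succ_iff.1 (lt_of_lt_of_le (Finset.card_lt_card ?_) hm)
          rw [Finset.ssubset_iff_of_subset]
          · refine ⟨w₀, by simp [hne, hw₀], ?_⟩
            simp [hTtop w₀ hw₀.ge, hr₀]
          · intro w hw
            simp only [Finset.mem_filter, Finsupp.mem_support_iff, Finsupp.sub_apply] at hw ⊢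
            refine ⟨fun h0 => hw.1 ?_, hw.2⟩
            rw [hTtop w hw.2.ge]
            simp [hr, h0]
      have hTr' : ∀ v, T v = r v := fun v => by rw [sub_eq_zero.1 hTr]
      obtain ⟨a₀, w, rfl⟩ := List.exists_cons_of_length_eq_add_one hw₀
      have hwn : w.length = n := by simpa using hw₀
      have hinj : Function.Injective (fun a : ι => a :: w) := fun a b hab => by simpa using hab
      set ρ : ι →₀ K := r.comapDomain (fun a => a :: w) hinj.injOn with hρ
      have hρa : ∀ a, ρ a = r (a :: w) := fun a => rfl
      have hfix : ∀ a, τ (ρ a) = ρ a := fun a => by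
        rw [hρa, ← hTtop _ (by simp [hwn]), hTr']
      have hzero : ρ = 0 := by
        refine hf ρ (r w) hfix ?_
        have key : T w = τ (r w) + ρ.sum (fun a k => k * f a) := by
          rw [hTapp, ← hdiag w]
          have : ρ.sum (fun a k => k * f a) =
              ∑ v ∈ r.support, if v ∈ Set.range (fun a : ι => a :: w) then
                τ (r v) * t v w else 0 := by
            rw [← Finset.sum_filter, Finsupp.sum]
            refine Finset.sum_bij (fun a _ => a :: w) ?_ ?_ ?_ ?_
            · intro a ha
              simpa [hρa] using ha
            · intro a _ b _ hab
              exact hinj hab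
            · intro v hv
              obtain ⟨hv, a, rfl⟩ := Finset.mem_filter.1 hv
              exact ⟨a, by simpa [hρa] using hv, rfl⟩
            · intro a _
              rw [ht₁ a w w rfl, Finsupp.single_eq_same, ← hρa, hfix]
          rw [this, ← Finset.sum_add_distrib]
          refine Finset.sum_congr rfl fun v hv => ?_
          by_cases hvl : v.length ≤ w.length
          · have : v ∉ Set.range (fun a : ι => a :: w) := by
              rintro ⟨a, rfl⟩
              simp at hvl
            rw [if_neg this, add_zero, ht₀ v w hvl]
          · have hvw : v ≠ w := fun e => hvl (by rw [e])
            rw [Finsupp.single_eq_of_ne (Ne.symm hvw), mul_zero, zero_add]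
            split_ifs with hmem
            · rfl
            · obtain ⟨a, v', rfl⟩ := List.exists_cons_of_length_pos
                (show 0 < v.length by omega)
              have h1 := hlen _ hv
              have hne' : v' ≠ w := fun e => hmem ⟨a, by simp [e]⟩
              rw [List.length_cons] at h1 hvl
              rw [ht₁ a v' w (by omega), Finsupp.single_eq_of_ne (Ne.symm hne'), mul_zero]
        rw [sub_add_eq_add_sub, ← key, hTr', sub_self]
      have := hρa a₀
      rw [hzero, hr₀] at this
      exact zero_ne_one this

section Regular
variable {K : Type*} [Field K] [Algebra ℝ[X] K] [IsFractionRing ℝ[X] K]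

variable (K) in
/-- The elements of the fraction field of `ℝ[X]` that have no pole at `z`. -/
def regularAt (z : ℝ) : Subalgebra ℝ[X] K where
  carrier := {g | ∃ p q : ℝ[X], q.eval z ≠ 0 ∧ g * algebraMap ℝ[X] K q = algebraMap ℝ[X] K p}
  mul_mem' := by
    rintro g h ⟨p, q, hq, hg⟩ ⟨p', q', hq', hh⟩
    refine ⟨p * p', q * q', by simp [hq, hq'], ?_⟩
    rw [map_mul, map_mul, ← hg, ← hh]
    ring
  add_mem' := by
    rintro g h ⟨p, q, hq, hg⟩ ⟨p', q', hq', hh⟩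
    refine ⟨p * q' + p' * q, q * q', by simp [hq, hq'], ?_⟩
    rw [map_mul, map_add, map_mul, map_mul, ← hg, ← hh]
    ring
  algebraMap_mem' p := ⟨p, 1, by simp, by simp⟩

theorem algebraMap_ne_zero_of_eval {z : ℝ} {q : ℝ[X]} (hq : q.eval z ≠ 0) :
    algebraMap ℝ[X] K q ≠ 0 := by
  rw [Ne, IsFractionRing.to_map_eq_zero_iff]
  rintro rfl
  simp at hq

theorem inv_algebraMap_mem_regularAt {z : ℝ} {q : ℝ[X]} (hq : q.eval z ≠ 0) :
    (algebraMap ℝ[X] K q)⁻¹ ∈ regularAt K z :=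
  ⟨1, q, hq, by rw [map_one, inv_mul_cancel₀ (algebraMap_ne_zero_of_eval hq)]⟩

theorem inv_algebraMap_notMem_regularAt {z : ℝ} {q : ℝ[X]} (hq : q ≠ 0) (hz : q.eval z = 0) :
    (algebraMap ℝ[X] K q)⁻¹ ∉ regularAt K z := by
  rintro ⟨p, r, hr, h⟩
  have h0 : algebraMap ℝ[X] K q ≠ 0 := by rwa [Ne, IsFractionRing.to_map_eq_zero_iff]
  rw [inv_mul_eq_iff_eq_mul₀ h0, ← map_mul] at h
  have := IsFractionRing.injective ℝ[X] K h
  rw [this, eval_mul, hz, zero_mul] at hr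
  exact hr rfl

theorem eventually_eval_ne_zero {q : ℝ[X]} (hq : q ≠ 0) (b : ℝ) {a : ℝ} (ha : a ≠ 0) :
    ∀ᶠ n : ℕ in atTop, q.eval (b + a * n) ≠ 0 := by
  have hinj : Function.Injective (fun n : ℕ => b + a * (n : ℝ)) := fun m n h => by
    simpa [ha] using h
  have hfin : {x : ℝ | q.eval x = 0}.Finite := by
    refine q.roots.toFinset.finite_toSet.subset fun x hx => ?_
    simpa [hq] using hx
  have := (hfin.preimage hinj.injOn).eventually_cofinite_notMem
  rw [Nat.cofinite_eq_atTop] at this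
  exact this

theorem eventually_mem_regularAt (g : K) (b : ℝ) {a : ℝ} (ha : a ≠ 0) :
    ∀ᶠ n : ℕ in atTop, g ∈ regularAt K (b + a * n) := by
  obtain ⟨p, q, hq, rfl⟩ := IsFractionRing.div_surjective (A := ℝ[X]) g
  filter_upwards [eventually_eval_ne_zero (nonZeroDivisors.ne_zero hq) b ha] with n hn
  rw [div_eq_mul_inv]
  exact mul_mem (algebraMap_mem _ _) (inv_algebraMap_mem_regularAt hn)

theorem exists_shift (r : ℝ) : ∃ τ : K →+* K,
    ∀ p : ℝ[X], τ (algebraMap ℝ[X] K p) = algebraMap ℝ[X] K (taylor r p) := by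
  have hinj : Function.Injective ((algebraMap ℝ[X] K).comp
      (taylorAlgHom r : ℝ[X] →ₐ[ℝ] ℝ[X]).toRingHom) := by
    refine (IsFractionRing.injective ℝ[X] K).comp (taylor_injective r)
  exact ⟨IsFractionRing.lift hinj, fun p => by
    rw [IsFractionRing.lift_algebraMap]; rfl⟩

variable (K) in
/-- The automorphism of the fraction field of `ℝ[X]` induced by `X ↦ X + r`. -/
noncomputable def shift (r : ℝ) : K →+* K := (exists_shift r).choose

theorem shift_algebraMap (r : ℝ) (p : ℝ[X]) :
    shift K r (algebraMap ℝ[X] K p) = algebraMap ℝ[X] K (taylor r p) :=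
  (exists_shift r).choose_spec p

theorem shift_neg_shift (r : ℝ) (g : K) : shift K (-r) (shift K r g) = g := by
  have : (shift K (-r)).comp (shift K r) = RingHom.id K := by
    refine IsLocalization.ringHom_ext (nonZeroDivisors ℝ[X]) (RingHom.ext fun p => ?_)
    simp [shift_algebraMap, taylor_taylor]
  exact congrArg (fun φ : K →+* K => φ g) this

theorem shift_mem_regularAt {r z : ℝ} {g : K} (hg : g ∈ regularAt K (z + r)) :
    shift K r g ∈ regularAt K z := by
  obtain ⟨p, q, hq, h⟩ := hg
  refine ⟨taylor r p, taylor r q, by rwa [taylor_eval], ?_⟩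
  rw [← shift_algebraMap, ← shift_algebraMap, ← map_mul, h]

theorem shift_mem_regularAt_iff {r z : ℝ} {g : K} :
    shift K r g ∈ regularAt K z ↔ g ∈ regularAt K (z + r) := by
  refine ⟨fun h => ?_, shift_mem_regularAt⟩
  rw [← shift_neg_shift r g]
  exact shift_mem_regularAt (by rwa [add_neg_cancel_right])

theorem mem_regularAt_of_telescope_right {r z : ℝ} (hr : r ≠ 0) {g : K}
    (h : ∀ n : ℕ, shift K r g - g ∈ regularAt K (z + r * n)) : g ∈ regularAt K z := by
  obtain ⟨N, hN⟩ := (eventually_mem_regularAt g z hr).exists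
  induction N with
  | zero => simpa using hN
  | succ N ih =>
    apply ih
    have h1 : shift K r g ∈ regularAt K (z + r * N) := by
      rw [shift_mem_regularAt_iff]
      convert hN using 2
      push_cast
      ring
    simpa using sub_mem h1 (h N)

theorem mem_regularAt_of_telescope_left {r z : ℝ} (hr : r ≠ 0) {g : K}
    (h : ∀ n : ℕ, shift K r g - g ∈ regularAt K (z - r * (n + 1))) : g ∈ regularAt K z := by
  obtain ⟨N, hN⟩ := (eventually_mem_regularAt g z (neg_ne_zero.2 hr)).exists
  induction N with
  | zero => simpa using hN
  | succ N ih =>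
    apply ih
    have h1 : g ∈ regularAt K (z - r * (N + 1)) := by
      convert hN using 2
      push_cast
      ring
    have h2 := add_mem (h N) h1
    rw [sub_add_cancel, shift_mem_regularAt_iff] at h2
    convert h2 using 2
    ring

/-- A rational function whose difference has poles in a given class modulo `r` at most at one
point has a difference without a pole at that point. -/
theorem telescope_mem_regularAt {r z : ℝ} (hr : r ≠ 0) {g : K}
    (h : ∀ x, x ≠ z → (∃ m : ℤ, x = z + r * m) → shift K r g - g ∈ regularAt K x) :
    shift K r g - g ∈ regularAt K z := by
  refine sub_mem (shift_mem_regularAt ?_) ?_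
  · refine mem_regularAt_of_telescope_right hr fun n => h _ ?_ ⟨n + 1, by push_cast; ring⟩
    rw [add_assoc, Ne, add_eq_left, show r + r * (n : ℝ) = r * (n + 1) by ring]
    exact mul_ne_zero hr (by positivity)
  · refine mem_regularAt_of_telescope_left hr fun n => h _ ?_ ⟨-(n + 1), by push_cast; ring⟩
    rw [Ne, sub_eq_self]
    exact mul_ne_zero hr (by positivity)

theorem mem_regularAt_of_shift_eq {r : ℝ} (hr : r ≠ 0) {g : K} (hg : shift K r g = g) (z : ℝ) :
    g ∈ regularAt K z :=
  mem_regularAt_of_telescope_right hr fun n => by simp [hg]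

variable (K) in
/-- The rational function `1 / (X + r)`. -/
noncomputable def invLin (r : ℝ) : K := (algebraMap ℝ[X] K (X + C r))⁻¹

theorem invLin_mem_regularAt {r z : ℝ} (h : z + r ≠ 0) : invLin K r ∈ regularAt K z :=
  inv_algebraMap_mem_regularAt (by simpa using h)

theorem invLin_notMem_regularAt (r : ℝ) : invLin K r ∉ regularAt K (-r) :=
  inv_algebraMap_notMem_regularAt (X_add_C_ne_zero r) (by simp)

theorem sum_fiber_eq_zero_of_mem_regularAt {ι : Type*} {r : ℝ} (hr : r ≠ 0) (s : Finset ι)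
    (ρ : ι → K) (d : ι → ℕ) (hd : ∀ i ∈ s, d i ≠ 0) (hρ : ∀ i ∈ s, shift K r (ρ i) = ρ i) (x : ℝ)
    (h : ∑ i ∈ s, ρ i * invLin K x ^ d i ∈ regularAt K (-x)) (k : ℕ) :
    ∑ i ∈ s with d i = k, ρ i = 0 := by
  classical
  set γ : ℕ → K := fun k => ∑ i ∈ s with d i = k, ρ i with hγ
  have hfix : ∀ k, shift K r (γ k) = γ k := fun k => by
    rw [hγ, map_sum]
    exact Finset.sum_congr rfl fun i hi => hρ i (Finset.mem_filter.1 hi).1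
  have hsum : ∑ i ∈ s, ρ i * invLin K x ^ d i =
      ∑ k ∈ s.image d, γ k * invLin K x ^ k := by
    rw [← Finset.sum_fiberwise_of_maps_to (fun i hi => Finset.mem_image_of_mem d hi)]
    refine Finset.sum_congr rfl fun k _ => ?_
    rw [hγ, Finset.sum_mul]
    exact Finset.sum_congr rfl fun i hi => by rw [(Finset.mem_filter.1 hi).2]
  rw [hsum] at h
  by_contra hk
  have hmem : ∀ k, γ k ≠ 0 → k ∈ s.image d := fun k hk => by
    obtain ⟨i, hi, -⟩ := Finset.exists_ne_zero_of_sum_ne_zero hk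
    rw [Finset.mem_filter] at hi
    exact Finset.mem_image.2 ⟨i, hi⟩
  obtain ⟨m, hm, hmax⟩ := ((s.image d).filter (fun k => γ k ≠ 0)).exists_max_image id
    ⟨k, Finset.mem_filter.2 ⟨hmem k hk, hk⟩⟩
  obtain ⟨hms, hm0⟩ := Finset.mem_filter.1 hm
  obtain ⟨n, rfl⟩ : ∃ n, m = n + 1 := by
    obtain ⟨i, hi, rfl⟩ := Finset.mem_image.1 hms
    exact Nat.exists_eq_add_one_of_ne_zero (hd i hi)
  set L : K := algebraMap ℝ[X] K (X + C x) with hL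
  have hL0 : L ≠ 0 := by
    rw [hL, Ne, IsFractionRing.to_map_eq_zero_iff]
    exact X_add_C_ne_zero x
  have hLu : L * invLin K x = 1 := mul_inv_cancel₀ hL0
  have hLmem : L ∈ regularAt K (-x) := algebraMap_mem _ _
  rw [← Finset.add_sum_erase _ _ hms] at h
  have h1 := mul_mem (mul_mem (mem_regularAt_of_shift_eq hr (g := (γ (n + 1))⁻¹)
    (by rw [map_inv₀, hfix]) (-x)) (pow_mem hLmem n)) h
  rw [mul_add, Finset.mul_sum] at h1
  have h2 : ∑ k ∈ (s.image d).erase (n + 1),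
      (γ (n + 1))⁻¹ * L ^ n * (γ k * invLin K x ^ k) ∈ regularAt K (-x) := by
    refine sum_mem fun k hk => ?_
    obtain ⟨hkn, hks⟩ := Finset.mem_erase.1 hk
    by_cases h0 : γ k = 0
    · simp [h0]
    have hle : k ≤ n + 1 := hmax k (Finset.mem_filter.2 ⟨hks, h0⟩)
    obtain ⟨j, rfl⟩ := Nat.exists_eq_add_of_le (show k ≤ n by omega)
    have : (γ (k + j + 1))⁻¹ * L ^ (k + j) * (γ k * invLin K x ^ k) =
        (γ (k + j + 1))⁻¹ * γ k * L ^ j := by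
      calc _ = (γ (k + j + 1))⁻¹ * γ k * L ^ j * (L * invLin K x) ^ k := by ring
        _ = _ := by rw [hLu, one_pow, mul_one]
    rw [this]
    exact mul_mem (mem_regularAt_of_shift_eq hr (by rw [map_mul, map_inv₀, hfix, hfix]) _)
      (pow_mem hLmem j)
  have h3 : (γ (n + 1))⁻¹ * L ^ n * (γ (n + 1) * invLin K x ^ (n + 1)) = invLin K x := by
    calc _ = ((γ (n + 1))⁻¹ * γ (n + 1)) * (L * invLin K x) ^ n * invLin K x := by ring
      _ = _ := by rw [hLu, one_pow, inv_mul_cancel₀ hm0, one_mul, one_mul]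
  rw [h3] at h1
  exact invLin_notMem_regularAt x (by simpa using sub_mem h1 h2)

theorem eq_zero_of_telescope (ρ : {a : ℤ // a ≠ 0} →₀ K) (g : K)
    (hρ : ∀ a, shift K 2 (ρ a) = ρ a)
    (h : shift K 2 g - g + ρ.sum (fun a r => r * (invLin K 1 ^ a.1.natAbs +
      (a.1.sign : K) * invLin K 2 ^ a.1.natAbs)) = 0) : ρ = 0 := by
  classical
  set A : K := ∑ a ∈ ρ.support, ρ a * invLin K 1 ^ a.1.natAbs with hA
  set B : K := ∑ a ∈ ρ.support, (ρ a * (a.1.sign : K)) * invLin K 2 ^ a.1.natAbs with hB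
  have hAB : shift K 2 g - g = -(A + B) := by
    rw [eq_neg_iff_add_eq_zero, ← h, hA, hB, ← Finset.sum_add_distrib, Finsupp.sum]
    congr 1
    exact Finset.sum_congr rfl fun a _ => by ring
  have hAreg : ∀ z : ℝ, z ≠ -1 → A ∈ regularAt K z := fun z hz => sum_mem fun a _ =>
    mul_mem (mem_regularAt_of_shift_eq two_ne_zero (hρ a) z)
      (pow_mem (invLin_mem_regularAt fun e => hz (by linarith)) _)
  have hfixB : ∀ a, shift K 2 (ρ a * (a.1.sign : K)) = ρ a * (a.1.sign : K) := fun a => by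
    rw [map_mul, hρ, map_intCast]
  have hBreg : ∀ z : ℝ, z ≠ -2 → B ∈ regularAt K z := fun z hz => sum_mem fun a _ =>
    mul_mem (mem_regularAt_of_shift_eq two_ne_zero (hfixB a) z)
      (pow_mem (invLin_mem_regularAt fun e => hz (by linarith)) _)
  have hA1 : A ∈ regularAt K (-1) := by
    have := telescope_mem_regularAt (K := K) (r := 2) (z := -1) (g := g) two_ne_zero (by
      rintro x hx ⟨m, rfl⟩
      rw [hAB]
      refine neg_mem (add_mem (hAreg _ hx) (hBreg _ fun e => ?_))
      have : 2 * m = -1 := by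
        have : (2 * m : ℝ) = -1 := by linarith
        exact_mod_cast this
      omega)
    rw [hAB] at this
    simpa using sub_mem (neg_mem this) (hBreg (-1) (by norm_num))
  have hB2 : B ∈ regularAt K (-2) := by
    have := telescope_mem_regularAt (K := K) (r := 2) (z := -2) (g := g) two_ne_zero (by
      rintro x hx ⟨m, rfl⟩
      rw [hAB]
      refine neg_mem (add_mem (hAreg _ fun e => ?_) (hBreg _ hx))
      have : 2 * m = 1 := by
        have : (2 * m : ℝ) = 1 := by linarith
        exact_mod_cast this
      omega)
    rw [hAB] at this
    simpa using sub_mem (neg_mem this) (hAreg (-2) (by norm_num))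
  have hd : ∀ a ∈ ρ.support, a.1.natAbs ≠ 0 := fun a _ => Int.natAbs_ne_zero.2 a.2
  ext a
  have e1 := sum_fiber_eq_zero_of_mem_regularAt two_ne_zero ρ.support ρ (fun a => a.1.natAbs) hd
    (fun a _ => hρ a) 1 hA1 a.1.natAbs
  have e2 := sum_fiber_eq_zero_of_mem_regularAt two_ne_zero ρ.support
    (fun a => ρ a * (a.1.sign : K)) (fun a => a.1.natAbs) hd
    (fun a _ => hfixB a) 2 hB2 a.1.natAbs
  have e3 : ∑ b ∈ ρ.support with b.1.natAbs = a.1.natAbs,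
      ρ b * (1 + (b.1.sign : K) * (a.1.sign : K)) = 0 := by
    have : ∀ b, ρ b * (1 + (b.1.sign : K) * (a.1.sign : K)) =
      ρ b + (ρ b * (b.1.sign : K)) * (a.1.sign : K) := fun b => by ring
    simp only [this]
    rw [Finset.sum_add_distrib, ← Finset.sum_mul, e1, e2, zero_mul, add_zero]
  have hsq : (a.1.sign : K) * (a.1.sign : K) = 1 := by
    rcases lt_or_gt_of_ne a.2 with h | h <;> simp [Int.sign_eq_neg_one_of_neg,
      Int.sign_eq_one_of_pos, h]
  have : CharZero K := charZero_of_injective_algebraMap (R := ℝ[X]) (IsFractionRing.injective _ _)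
  rw [Finset.sum_eq_single a, hsq] at e3
  · simpa [one_add_one_eq_two] using e3
  · intro b hb hba
    have hba' : b.1 ≠ a.1 := fun e => hba (Subtype.ext e)
    have hneg : b.1 = -a.1 :=
      (Int.natAbs_eq_natAbs_iff.1 (Finset.mem_filter.1 hb).2).resolve_left hba'
    rw [hneg, Int.sign_neg, Int.cast_neg, neg_mul, hsq, add_neg_cancel, mul_zero]
  · intro ha
    have : ρ a = 0 := by simpa using ha
    simp [this]

end Regular

section Coefficients

variable (K : Type*) [Field K] [Algebra ℝ[X] K]

/-- Coefficients of `S_w(m + 1)`, for odd `m`, in terms of the sums `S_v(m)`. -/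
noncomputable def coeffSucc : List {a : ℤ // a ≠ 0} → List {a : ℤ // a ≠ 0} →₀ K
  | [] => Finsupp.single [] 1
  | a :: w => Finsupp.single (a :: w) 1 + invLin K 1 ^ a.1.natAbs • coeffSucc w

/-- Coefficients of `S_w(m + 2)`, for odd `m`, in terms of the sums `S_v(m)`. -/
noncomputable def coeffAddTwo : List {a : ℤ // a ≠ 0} → List {a : ℤ // a ≠ 0} →₀ K
  | [] => Finsupp.single [] 1
  | a :: w => coeffSucc K (a :: w) +
      ((a.1.sign : K) * invLin K 2 ^ a.1.natAbs) • coeffAddTwo w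

variable {K}

theorem coeffSucc_apply {w v : List {a : ℤ // a ≠ 0}} (h : w.length ≤ v.length) :
    coeffSucc K w v = Finsupp.single w 1 v := by
  induction w with
  | nil => rfl
  | cons a w ih =>
    rw [List.length_cons] at h
    have hne : v ≠ w := by rintro rfl; omega
    rw [coeffSucc, Finsupp.add_apply, Finsupp.smul_apply, ih (by omega),
      Finsupp.single_eq_of_ne hne, smul_zero, add_zero]

theorem coeffAddTwo_apply {w v : List {a : ℤ // a ≠ 0}} (h : w.length ≤ v.length) :
    coeffAddTwo K w v = Finsupp.single w 1 v := by
  induction w with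
  | nil => rfl
  | cons a w ih =>
    rw [coeffAddTwo, Finsupp.add_apply, Finsupp.smul_apply, coeffSucc_apply h]
    rw [List.length_cons] at h
    have hne : v ≠ w := by rintro rfl; omega
    rw [ih (by omega), Finsupp.single_eq_of_ne hne, smul_zero, add_zero]

theorem coeffAddTwo_cons_apply (a : {a : ℤ // a ≠ 0}) {w v : List {a : ℤ // a ≠ 0}}
    (h : w.length = v.length) : coeffAddTwo K (a :: w) v =
      Finsupp.single w (invLin K 1 ^ a.1.natAbs + (a.1.sign : K) * invLin K 2 ^ a.1.natAbs) v := by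
  have hne : v ≠ a :: w := by rintro rfl; simp at h
  rw [coeffAddTwo, coeffSucc, Finsupp.add_apply, Finsupp.add_apply, Finsupp.smul_apply,
    Finsupp.smul_apply, coeffSucc_apply h.le, coeffAddTwo_apply h.le,
    Finsupp.single_eq_of_ne hne, zero_add, ← add_smul, ← Finsupp.smul_apply, Finsupp.smul_single,
    smul_eq_mul, mul_one]

end Coefficients

section Germs

/-- Evaluation of polynomials along the odd natural numbers, up to finitely many of them. -/
noncomputable def oddEval : ℝ[X] →+* Germ (atTop : Filter ℕ) ℝ :=
  (Germ.coeRingHom atTop).comp (RingHom.pi fun n : ℕ => evalRingHom (1 + 2 * (n : ℝ)))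

theorem oddEval_apply (p : ℝ[X]) :
    oddEval p = ((fun n : ℕ => p.eval (1 + 2 * (n : ℝ)) : ℕ → ℝ) : Germ atTop ℝ) :=
  rfl

theorem oddEval_mul_inv {p : ℝ[X]} (hp : p ≠ 0) :
    oddEval p * ((fun n : ℕ => (p.eval (1 + 2 * (n : ℝ)))⁻¹ : ℕ → ℝ) : Germ atTop ℝ) = 1 := by
  rw [oddEval_apply, ← Germ.coe_mul]
  refine Germ.coe_eq.2 ?_
  filter_upwards [eventually_eval_ne_zero hp 1 two_ne_zero] with n hn
  exact mul_inv_cancel₀ hn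

/-- The map `n ↦ n + 1` on germs of sequences. -/
def germSucc : Germ (atTop : Filter ℕ) ℝ →+* Germ (atTop : Filter ℕ) ℝ where
  toFun g := g.compTendsto (fun n => n + 1) (tendsto_add_atTop_nat 1)
  map_one' := rfl
  map_zero' := rfl
  map_mul' f g := Germ.inductionOn₂ f g fun _ _ => rfl
  map_add' f g := Germ.inductionOn₂ f g fun _ _ => rfl

theorem germSucc_coe (f : ℕ → ℝ) :
    germSucc (f : Germ atTop ℝ) = ((fun n => f (n + 1) : ℕ → ℝ) : Germ atTop ℝ) :=
  rfl

variable (K : Type*) [Field K] [Algebra ℝ[X] K] [IsFractionRing ℝ[X] K]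

/-- Evaluation of rational functions along the odd natural numbers, up to finitely many. -/
noncomputable def oddEvalFrac : K →+* Germ (atTop : Filter ℕ) ℝ :=
  IsLocalization.lift (M := nonZeroDivisors ℝ[X]) (g := oddEval) fun p =>
    IsUnit.of_mul_eq_one _ (oddEval_mul_inv (nonZeroDivisors.ne_zero p.2))

theorem oddEvalFrac_algebraMap (p : ℝ[X]) :
    oddEvalFrac K (algebraMap ℝ[X] K p) = oddEval p :=
  IsLocalization.lift_eq _ p

theorem oddEvalFrac_invLin (r : ℝ) : oddEvalFrac K (invLin K r) =
    ((fun n : ℕ => (1 + 2 * (n : ℝ) + r)⁻¹ : ℕ → ℝ) : Germ atTop ℝ) := by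
  have hp := X_add_C_ne_zero (R := ℝ) r
  have h0 : algebraMap ℝ[X] K (X + C r) ≠ 0 := by
    rwa [Ne, IsFractionRing.to_map_eq_zero_iff]
  have h1 : oddEval (X + C r) * oddEvalFrac K (invLin K r) = 1 := by
    rw [← oddEvalFrac_algebraMap K, ← map_mul, invLin, mul_inv_cancel₀ h0, map_one]
  have h2 := oddEval_mul_inv hp
  simpa using left_inv_eq_right_inv ((mul_comm _ _).trans h1) h2

theorem germSucc_oddEvalFrac (k : K) :
    germSucc (oddEvalFrac K k) = oddEvalFrac K (shift K 2 k) := by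
  have : (germSucc).comp (oddEvalFrac K) = (oddEvalFrac K).comp (shift K 2) := by
    refine IsLocalization.ringHom_ext (nonZeroDivisors ℝ[X]) (RingHom.ext fun p => ?_)
    simp only [RingHom.comp_apply, shift_algebraMap, oddEvalFrac_algebraMap, oddEval_apply,
      germSucc_coe, taylor_eval]
    congr 1
    ext n
    congr 1
    push_cast
    ring
  exact congrArg (fun φ : K →+* _ => φ k) this

/-- The germ of `n ↦ S_w(2n + 1 + j)`. -/
noncomputable def oddGerm (j : ℕ) (w : List ℤ) : Germ (atTop : Filter ℕ) ℝ :=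
  ((fun n => nestedS w (2 * n + 1 + j) : ℕ → ℝ) : Germ atTop ℝ)

theorem nestedS_cons_succ (a : ℤ) (b : List ℤ) (N : ℕ) :
    nestedS (a :: b) (N + 1) = nestedS (a :: b) N +
      (Int.sign a : ℝ) ^ (N + 1) / ((N + 1 : ℕ) : ℝ) ^ a.natAbs * nestedS b (N + 1) := by
  rw [nestedS, nestedS, Finset.sum_Icc_succ_top (by omega)]

theorem sign_pow_odd (a : ℤ) (n : ℕ) : (Int.sign a : ℝ) ^ (2 * n + 1) = Int.sign a := by
  rcases lt_trichotomy a 0 with h | rfl | h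
  · rw [Int.sign_eq_neg_one_of_neg h]
    simp [pow_succ, pow_mul]
  · simp
  · simp [Int.sign_eq_one_of_pos h]

theorem sign_pow_even {a : ℤ} (ha : a ≠ 0) (n : ℕ) : (Int.sign a : ℝ) ^ (2 * n) = 1 := by
  rcases lt_or_gt_of_ne ha with h | h
  · rw [Int.sign_eq_neg_one_of_neg h]
    simp [pow_mul]
  · simp [Int.sign_eq_one_of_pos h]

theorem oddGerm_cons_one {a : ℤ} (ha : a ≠ 0) (b : List ℤ) :
    oddGerm 1 (a :: b) = oddGerm 0 (a :: b) +
      oddEvalFrac K (invLin K 1 ^ a.natAbs) * oddGerm 1 b := by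
  rw [map_pow, oddEvalFrac_invLin, oddGerm, oddGerm, oddGerm, ← Germ.coe_pow, ← Germ.coe_mul,
    ← Germ.coe_add]
  congr 1
  ext n
  simp only [Pi.add_apply, Pi.mul_apply, Pi.pow_apply]
  rw [nestedS_cons_succ, show 2 * n + 1 + 1 = 2 * (n + 1) by ring, sign_pow_even ha, inv_pow,
    one_div]
  congr 4
  push_cast
  ring

theorem oddGerm_cons_two (a : ℤ) (b : List ℤ) :
    oddGerm 2 (a :: b) = oddGerm 1 (a :: b) +
      oddEvalFrac K ((a.sign : K) * invLin K 2 ^ a.natAbs) * oddGerm 2 b := by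
  rw [map_mul, map_intCast, map_pow, oddEvalFrac_invLin, oddGerm, oddGerm, oddGerm,
    ← Germ.intCast_def, ← Germ.coe_pow, ← Germ.coe_mul, ← Germ.coe_mul, ← Germ.coe_add]
  congr 1
  ext n
  simp only [Pi.add_apply, Pi.mul_apply, Pi.pow_apply]
  rw [← add_assoc (2 * n + 1) 1 1, nestedS_cons_succ,
    show 2 * n + 1 + 1 + 1 = 2 * (n + 1) + 1 by ring, sign_pow_odd, inv_pow, div_eq_mul_inv]
  congr 5
  push_cast
  ring

variable {K}

/-- Nested harmonic sums are linearly independent over the rational functions, even when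
restricted to almost all odd arguments. -/
theorem eq_zero_of_sum_oddGerm (l : List {a : ℤ // a ≠ 0} →₀ K)
    (h : l.sum (fun w k => oddEvalFrac K k * oddGerm 0 (w.map (↑))) = 0) : l = 0 := by
  let _ : Module K (Germ (atTop : Filter ℕ) ℝ) := Module.compHom _ (oddEvalFrac K)
  have smul_def : ∀ (k : K) (x : Germ (atTop : Filter ℕ) ℝ), k • x = oddEvalFrac K k * x :=
    fun _ _ => rfl
  have hsucc : ∀ w, Finsupp.linearCombination K (fun w : List {a : ℤ // a ≠ 0} =>
      oddGerm 0 (w.map (↑))) (coeffSucc K w) = oddGerm 1 (w.map (↑)) := fun w => by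
    induction w with
    | nil =>
      rw [coeffSucc, Finsupp.linearCombination_single, one_smul]
      rfl
    | cons a w ih =>
      rw [coeffSucc, map_add, map_smul, ih, Finsupp.linearCombination_single, one_smul, smul_def,
        List.map_cons, oddGerm_cons_one K a.2]
  have htwo : ∀ w, Finsupp.linearCombination K (fun w : List {a : ℤ // a ≠ 0} =>
      oddGerm 0 (w.map (↑))) (coeffAddTwo K w) = oddGerm 2 (w.map (↑)) := fun w => by
    induction w with
    | nil =>
      rw [coeffAddTwo, Finsupp.linearCombination_single, one_smul]
      rfl
    | cons a w ih =>
      rw [coeffAddTwo, map_add, map_smul, ih, hsucc, smul_def, List.map_cons,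
        oddGerm_cons_two K]
  have hli := linearIndependent_of_unipotent_shift (shift K 2) germSucc.toAddMonoidHom
    (fun k x => by
      simp only [smul_def, RingHom.toAddMonoidHom_eq_coe, AddMonoidHom.coe_coe, map_mul,
        germSucc_oddEvalFrac])
    (fun w : List {a : ℤ // a ≠ 0} => oddGerm 0 (w.map (↑)))
    (fun h => one_ne_zero (α := Germ (atTop : Filter ℕ) ℝ) (by
      rw [← h, List.map_nil, oddGerm]
      simp only [nestedS]
      rfl))
    (coeffAddTwo K) _
    (fun w => by
      rw [htwo]
      simp only [oddGerm, RingHom.toAddMonoidHom_eq_coe, AddMonoidHom.coe_coe, germSucc_coe]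
      congr 1)
    (fun w v => coeffAddTwo_apply) (fun a w v => coeffAddTwo_cons_apply a)
    (fun ρ g => eq_zero_of_telescope ρ g)
  exact linearIndependent_iff.1 hli l h

theorem sum_fiber_tail_eq_zero (s : Finset (List ℤ)) (hs : ∀ a ∈ s, ∀ x ∈ a.tail, x ≠ 0)
    (κ : List ℤ → K)
    (h : ∑ a ∈ s, oddEvalFrac K (κ a) * oddGerm 0 a.tail = 0) (b : List ℤ) :
    ∑ a ∈ s with a.tail = b, κ a = 0 := by
  classical
  set lift : List ℤ → List {a : ℤ // a ≠ 0} :=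
    List.map (fun x => if hx : x ≠ 0 then ⟨x, hx⟩ else ⟨1, one_ne_zero⟩) with hlift
  have hval : ∀ w : List ℤ, (∀ x ∈ w, x ≠ 0) → (lift w).map (↑) = w := fun w hw => by
    rw [hlift, List.map_map]
    conv_rhs => rw [← List.map_id w]
    exact List.map_congr_left fun x hx => by simp [hw x hx]
  have h0 := eq_zero_of_sum_oddGerm (K := K)
    (∑ a ∈ s, Finsupp.single (lift a.tail) (κ a)) (by
      rw [← Finsupp.sum_finsetSum_index (by simp) (by simp [add_mul])]
      rw [← h]
      refine Finset.sum_congr rfl fun a ha => ?_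
      rw [Finsupp.sum_single_index (by simp), hval _ (hs a ha)])
  by_cases hb : ∃ a ∈ s, a.tail = b
  · obtain ⟨a₀, ha₀, rfl⟩ := hb
    have h1 := DFunLike.congr_fun h0 (lift a₀.tail)
    rw [Finsupp.finsetSum_apply] at h1
    rw [Finset.sum_filter]
    refine Eq.trans (Finset.sum_congr rfl fun a ha => ?_) h1
    rw [Finsupp.single_apply]
    refine if_congr ⟨fun e => by rw [e], fun e => ?_⟩ rfl rfl
    rw [← hval _ (hs a ha), e, hval _ (hs a₀ ha₀)]
  · refine Finset.sum_eq_zero fun a ha => (hb ⟨a, ?_⟩).elim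
    simpa using ha

end Germs

theorem sum_nestedS_odd_sub_even (c : List ℤ →₀ ℝ) (hc : ∀ a ∈ c.support, a ≠ []) (n : ℕ) :
    (∑ a ∈ c.support, c a * nestedS a (2 * n + 1)) - ∑ a ∈ c.support, c a * nestedS a (2 * n) =
      ∑ a ∈ c.support, c a * (a.headI.sign : ℝ) * ((1 + 2 * (n : ℝ)) ^ a.headI.natAbs)⁻¹ *
        nestedS a.tail (2 * n + 1) := by
  rw [← Finset.sum_sub_distrib]
  refine Finset.sum_congr rfl fun a ha => ?_
  obtain ⟨h, b, rfl⟩ := List.exists_cons_of_ne_nil (hc a ha)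
  rw [nestedS_cons_succ, sign_pow_odd, List.headI_cons, List.tail_cons,
    show ((2 * n + 1 : ℕ) : ℝ) = 1 + 2 * (n : ℝ) by push_cast; ring]
  ring

/-- Shift symmetry `S(2n+1) = S(2n)` for a finite linear combination
`S(n) = Σ_a c(a)·S_a(n)` of nested harmonic sums (over nonempty lists of nonzero
integers) holds iff the coefficients satisfy `c((a)⌢b) = c((−a)⌢b)`. -/
theorem shift_symmetry_even_iff (c : List ℤ →₀ ℝ)
    (hsupp : ∀ a ∈ c.support, a ≠ [] ∧ ∀ x ∈ a, x ≠ 0) :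
    (∀ n : ℕ, (∑ a ∈ c.support, c a * nestedS a (2 * n + 1)) =
        ∑ a ∈ c.support, c a * nestedS a (2 * n)) ↔
      ∀ (a : ℤ), a ≠ 0 → ∀ (b : List ℤ), (∀ x ∈ b, x ≠ 0) →
        c (a :: b) = c ((-a) :: b) := by
  classical
  have hne : ∀ a ∈ c.support, a ≠ [] := fun a ha => (hsupp a ha).1
  rw [forall_congr' fun n => by rw [← sub_eq_zero, sum_nestedS_odd_sub_even c hne]]
  have hcons : ∀ a ∈ c.support, a.headI :: a.tail = a := fun a ha => by
    obtain ⟨h, b, rfl⟩ := List.exists_cons_of_ne_nil (hne a ha)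
    rfl
  have hhead : ∀ a ∈ c.support, a.headI ≠ 0 := fun a ha => by
    have := (hsupp a ha).2 a.headI
    rw [← hcons a ha] at this ⊢
    exact this (by simp)
  have htail : ∀ a ∈ c.support, ∀ x ∈ a.tail, x ≠ 0 := fun a ha x hx =>
    (hsupp a ha).2 x (List.mem_of_mem_tail hx)
  constructor
  · intro h a ha b _
    let κ : List ℤ → RatFunc ℝ := fun w =>
      algebraMap ℝ[X] (RatFunc ℝ) (C (c w * (w.headI.sign : ℝ))) *
        invLin (RatFunc ℝ) 0 ^ w.headI.natAbs
    have h1 := sum_fiber_tail_eq_zero c.support htail κ (by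
      have : ∀ w : List ℤ, oddEvalFrac (RatFunc ℝ) (κ w) * oddGerm 0 w.tail =
          Germ.coeRingHom (R := ℝ) (atTop : Filter ℕ) (fun n : ℕ => c w * (w.headI.sign : ℝ) *
            ((1 + 2 * (n : ℝ)) ^ w.headI.natAbs)⁻¹ * nestedS w.tail (2 * n + 1)) := fun w => by
        rw [map_mul, oddEvalFrac_algebraMap, map_pow, oddEvalFrac_invLin, oddEval_apply, oddGerm,
          ← Germ.coe_pow, ← Germ.coe_mul, ← Germ.coe_mul]
        refine congrArg (Germ.ofFun (l := atTop)) (funext fun n => ?_)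
        simp [inv_pow]
      simp only [this]
      rw [← map_sum, ← map_zero (Germ.coeRingHom (R := ℝ) (atTop : Filter ℕ))]
      congr 1
      ext n
      simpa using h n) b
    have h2 := sum_fiber_eq_zero_of_mem_regularAt (K := RatFunc ℝ) (r := 2) two_ne_zero
      {w ∈ c.support | w.tail = b}
      (fun w => algebraMap ℝ[X] (RatFunc ℝ) (C (c w * (w.headI.sign : ℝ))))
      (fun w => w.headI.natAbs)
      (fun w hw => Int.natAbs_ne_zero.2 (hhead w (Finset.mem_filter.1 hw).1))
      (fun w _ => by rw [shift_algebraMap, taylor_C]) 0 (by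
        rw [h1]
        exact zero_mem _) a.natAbs
    rw [← map_sum, ← map_sum, IsFractionRing.to_map_eq_zero_iff, C_eq_zero, Finset.filter_filter]
      at h2
    have hnn : a :: b ≠ -a :: b := fun e => ha (by
      have := (List.cons.inj e).1
      omega)
    have hsub : ∑ w ∈ c.support with w.tail = b ∧ w.headI.natAbs = a.natAbs,
        c w * (w.headI.sign : ℝ) = ∑ w ∈ {a :: b, -a :: b}, c w * (w.headI.sign : ℝ) := by
      refine Finset.sum_subset (fun w hw => ?_) (fun w hw hw' => ?_)
      · obtain ⟨hw, hb, hw'⟩ := Finset.mem_filter.1 hw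
        rw [← hcons w hw, hb]
        rcases Int.natAbs_eq_natAbs_iff.1 hw' with e | e <;> simp [e]
      · by_contra h0
        apply hw'
        refine Finset.mem_filter.2 ⟨Finsupp.mem_support_iff.2 (left_ne_zero_of_mul h0), ?_⟩
        rcases Finset.mem_insert.1 hw with rfl | hw
        · simp
        · rw [Finset.mem_singleton.1 hw]
          simp
    rw [hsub, Finset.sum_pair hnn, List.headI_cons, List.headI_cons, Int.sign_neg, Int.cast_neg,
      mul_neg, ← sub_eq_add_neg, ← sub_mul] at h2
    have hs : (a.sign : ℝ) ≠ 0 := by simpa using ha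
    exact sub_eq_zero.1 ((mul_eq_zero.1 h2).resolve_right hs)
  · intro h n
    refine Finset.sum_involution (fun a _ => -a.headI :: a.tail) ?_ ?_ ?_ ?_
    · intro a ha
      have := h a.headI (hhead a ha) a.tail (htail a ha)
      rw [hcons a ha] at this
      simp only [← this, List.headI_cons, List.tail_cons, Int.sign_neg, Int.natAbs_neg]
      push_cast
      ring
    · intro a ha _ e
      have := congrArg List.headI e
      have := hhead a ha
      simp only [List.headI_cons] at *
      omega
    · intro a ha
      have := h a.headI (hhead a ha) a.tail (htail a ha)
      rw [hcons a ha] at this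
      rw [Finsupp.mem_support_iff, ← this]
      exact Finsupp.mem_support_iff.1 ha
    · intro a ha
      simpa using hcons a ha
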